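/- Let D be an n₁×n₂ real matrix with singular value decomposition D = Q S Rᵀ, where Q, R are orthogonal and S is rectangular diagonal with descending nonnegative diagonal entries s₁ ≥ … ≥ s_r ≥ 0, r = min{n₁,n₂}. Let λ, ρ > 0 and ψ : ℝ → ℝ. Suppose that for each i, σ_i* ≥ 0 minimizes the scalar function σ ↦ λ ψ(σ) + (ρ/2)(σ − s_i)² over σ ≥ 0. Then: (a) the matrix W* = Q Σ* Rᵀ, where Σ* is the rectangular diagonal matrix with diagonal entries σ_i*, satisfies ‖W* − D‖_F² = Σ_{i=1}^{r} (σ_i* − s_i)²; and (b) for every n₁×n₂ real matrix W with singular value decomposition W = U Σ Vᵀ (U, V orthogonal, Σ rectangular diagonal with descending nonnegative entries σ₁ ≥ … ≥ σ_r ≥ 0), one has λ Σ_{i=1}^{r} ψ(σ_i) + (ρ/2)‖W − D‖_F² ≥ λ Σ_{i=1}^{r} ψ(σ_i*) + (ρ/2) Σ_{i=1}^{r} (σ_i* − s_i)². -/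

import Mathlib

open Matrix

/-- Rectangular diagonal matrix with diagonal entries given by `σ`. -/
def rectDiag (n₁ n₂ : ℕ) (σ : ℕ → ℝ) : Matrix (Fin n₁) (Fin n₂) ℝ :=
  fun i j => if (i : ℕ) = (j : ℕ) then σ (i : ℕ) else 0

/-- Squared Frobenius norm. -/
def frobSq {n₁ n₂ : ℕ} (A : Matrix (Fin n₁) (Fin n₂) ℝ) : ℝ :=
  ∑ i, ∑ j, (A i j) ^ 2

lemma abel_dom (a d : ℕ → ℝ) (m : ℕ)
    (ha : ∀ i j : ℕ, i ≤ j → j < m + 1 → a j ≤ a i)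
    (hd : ∀ k ≤ m + 1, 0 ≤ ∑ i ∈ Finset.range k, d i) :
    a m * ∑ i ∈ Finset.range (m + 1), d i ≤ ∑ i ∈ Finset.range (m + 1), a i * d i := by
  induction m with
  | zero => simp
  | succ m ih =>
    have h1 := ih (fun i j h h' => ha i j h (by omega)) (fun k hk => hd k (by omega))
    have h2 := ha m (m + 1) (by omega) (by omega)
    have h3 := hd (m + 1) (by omega)
    rw [Finset.sum_range_succ, Finset.sum_range_succ (fun i => a i * d i)]
    nlinarith

lemma weighted_le (b c : ℕ → ℝ) (r m : ℕ) (hm : m ≤ r)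
    (hb : ∀ i j : ℕ, i ≤ j → j < r → b j ≤ b i) (hb0 : ∀ i < r, 0 ≤ b i)
    (hc0 : ∀ k, 0 ≤ c k) (hc1 : ∀ k < r, c k ≤ 1)
    (hc : ∑ k ∈ Finset.range r, c k ≤ m) :
    ∑ k ∈ Finset.range r, b k * c k ≤ ∑ k ∈ Finset.range m, b k := by
  rcases Nat.eq_zero_or_pos m with rfl | hpos
  · have h0 : ∀ k ∈ Finset.range r, c k = 0 := by
      have : ∑ k ∈ Finset.range r, c k = 0 :=
        le_antisymm (by simpa using hc) (Finset.sum_nonneg fun k _ => hc0 k)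
      exact (Finset.sum_eq_zero_iff_of_nonneg (fun k _ => hc0 k)).1 this
    rw [Finset.sum_eq_zero (fun k hk => by rw [h0 k hk, mul_zero])]
    simp
  · set t := b (m - 1) with ht
    have ht0 : 0 ≤ t := hb0 _ (by omega)
    have key : ∑ k ∈ Finset.range r, (b k - t) * c k ≤ ∑ k ∈ Finset.range m, (b k - t) := by
      rw [← Finset.sum_range_add_sum_Ico _ hm]
      have h1 : ∑ k ∈ Finset.range m, (b k - t) * c k ≤ ∑ k ∈ Finset.range m, (b k - t) := by
        apply Finset.sum_le_sum
        intro k hk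
        have hk := Finset.mem_range.1 hk
        have := hb k (m - 1) (by omega) (by omega)
        have := hc1 k (by omega)
        nlinarith
      have h2 : ∑ k ∈ Finset.Ico m r, (b k - t) * c k ≤ 0 := by
        apply Finset.sum_nonpos
        intro k hk
        have hk := Finset.mem_Ico.1 hk
        have := hb (m - 1) k (by omega) (by omega)
        have := hc0 k
        nlinarith
      linarith
    simp only [sub_mul, Finset.sum_sub_distrib, ← Finset.mul_sum, Finset.sum_const,
      Finset.card_range, nsmul_eq_mul] at key
    nlinarith

lemma substoch (a b : ℕ → ℝ) (P : ℕ → ℕ → ℝ) (r : ℕ)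
    (ha : ∀ i j : ℕ, i ≤ j → j < r → a j ≤ a i) (ha0 : ∀ i < r, 0 ≤ a i)
    (hb : ∀ i j : ℕ, i ≤ j → j < r → b j ≤ b i) (hb0 : ∀ i < r, 0 ≤ b i)
    (hP : ∀ i k, 0 ≤ P i k)
    (hrow : ∀ i < r, ∑ k ∈ Finset.range r, P i k ≤ 1)
    (hcol : ∀ k < r, ∑ i ∈ Finset.range r, P i k ≤ 1) :
    ∑ i ∈ Finset.range r, a i * ∑ k ∈ Finset.range r, b k * P i k ≤
      ∑ i ∈ Finset.range r, a i * b i := by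
  rcases r with _ | m
  · simp
  have hd : ∀ k ≤ m + 1, 0 ≤ ∑ i ∈ Finset.range k,
      (b i - ∑ k ∈ Finset.range (m + 1), b k * P i k) := by
    intro n hn
    rw [Finset.sum_sub_distrib, Finset.sum_comm]
    simp only [← Finset.mul_sum]
    have := weighted_le b (fun k => ∑ i ∈ Finset.range n, P i k) (m + 1) n hn hb hb0
      (fun k => Finset.sum_nonneg fun i _ => hP i k)
      (fun k hk => (Finset.sum_le_sum_of_subset_of_nonneg
        (Finset.range_mono hn) (fun i _ _ => hP i k)).trans (hcol k hk))
      (by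
        rw [Finset.sum_comm]
        calc _ ≤ ∑ i ∈ Finset.range n, (1 : ℝ) := Finset.sum_le_sum fun i hi =>
              hrow i (lt_of_lt_of_le (Finset.mem_range.1 hi) hn)
          _ = n := by simp)
    linarith
  have h := abel_dom a _ m ha hd
  have h0 := mul_nonneg (ha0 m (by omega)) (hd (m + 1) le_rfl)
  simp only [mul_sub, Finset.sum_sub_distrib] at h h0
  linarith

lemma diag_sum (n₁ n₂ : ℕ) (g : Fin n₁ → Fin n₂ → ℝ) :
    ∑ i : Fin n₁, ∑ j : Fin n₂, (if (i : ℕ) = (j : ℕ) then g i j else 0) =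
      ∑ k : Fin (min n₁ n₂),
        g (Fin.castLE (min_le_left _ _) k) (Fin.castLE (min_le_right _ _) k) := by
  rw [← Finset.sum_product', ← Finset.sum_filter]
  symm
  refine Finset.sum_bij (fun k _ =>
    (Fin.castLE (min_le_left _ _) k, Fin.castLE (min_le_right _ _) k)) ?_ ?_ ?_ ?_
  · intro k _; simp
  · intro k _ l _ h
    simpa [Fin.ext_iff] using h
  · rintro ⟨i, j⟩ h
    have h : (i : ℕ) = j := by simpa using h
    refine ⟨⟨i, lt_min i.2 (h ▸ j.2)⟩, Finset.mem_univ _, ?_⟩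
    ext <;> simp [h]
  · intros; rfl

lemma frobSq_eq {n₁ n₂ : ℕ} (A : Matrix (Fin n₁) (Fin n₂) ℝ) :
    frobSq A = (Aᵀ * A).trace := by
  simp only [frobSq, Matrix.trace, Matrix.diag, Matrix.mul_apply, Matrix.transpose_apply]
  rw [Finset.sum_comm]
  simp [sq]

lemma frobSq_orth {n₁ n₂ : ℕ} (Q : Matrix (Fin n₁) (Fin n₁) ℝ) (R : Matrix (Fin n₂) (Fin n₂) ℝ)
    (M : Matrix (Fin n₁) (Fin n₂) ℝ) (hQ : Qᵀ * Q = 1) (hR : Rᵀ * R = 1) :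
    frobSq (Q * M * Rᵀ) = frobSq M := by
  rw [frobSq_eq, frobSq_eq, Matrix.trace_mul_comm]
  have : Q * M * Rᵀ * (Q * M * Rᵀ)ᵀ = Q * (M * (Rᵀ * R) * Mᵀ * Qᵀ) := by
    simp only [Matrix.transpose_mul, Matrix.transpose_transpose, Matrix.mul_assoc]
  rw [this, Matrix.trace_mul_comm, hR, Matrix.mul_assoc, hQ, Matrix.mul_one, Matrix.mul_one,
    Matrix.trace_mul_comm]

lemma frobSq_rectDiag (n₁ n₂ : ℕ) (σ : ℕ → ℝ) :
    frobSq (rectDiag n₁ n₂ σ) = ∑ i ∈ Finset.range (min n₁ n₂), σ i ^ 2 := by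
  have := diag_sum n₁ n₂ (fun i _ => σ i ^ 2)
  simp only [Fin.val_castLE] at this
  rw [Finset.sum_range, ← this]
  simp [frobSq, rectDiag, ite_pow]

lemma frobSq_sub {n₁ n₂ : ℕ} (A B : Matrix (Fin n₁) (Fin n₂) ℝ) :
    frobSq (A - B) = frobSq A + frobSq B - 2 * ∑ i, ∑ j, A i j * B i j := by
  simp only [frobSq, Finset.mul_sum, ← Finset.sum_add_distrib, ← Finset.sum_sub_distrib,
    Matrix.sub_apply]
  refine Finset.sum_congr rfl fun i _ => Finset.sum_congr rfl fun j _ => ?_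
  ring

lemma rect_apply (n₁ n₂ : ℕ) (A : Matrix (Fin n₁) (Fin n₁) ℝ) (B : Matrix (Fin n₂) (Fin n₂) ℝ)
    (σ : ℕ → ℝ) (i : Fin n₁) (j : Fin n₂) :
    (A * rectDiag n₁ n₂ σ * Bᵀ) i j = ∑ k : Fin (min n₁ n₂),
      σ k * (A i (Fin.castLE (min_le_left _ _) k) * B j (Fin.castLE (min_le_right _ _) k)) := by
  have := diag_sum n₁ n₂ (fun k l => σ k * (A i k * B j l))
  simp only [Fin.val_castLE] at this
  rw [← this, Finset.sum_comm]
  simp only [Matrix.mul_apply, Matrix.transpose_apply, rectDiag, Finset.sum_mul]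
  refine Finset.sum_congr rfl fun k _ => Finset.sum_congr rfl fun l _ => ?_
  split_ifs <;> ring

lemma sub_row {n r : ℕ} (h : r ≤ n) (A : Matrix (Fin n) (Fin n) ℝ) (hA : A * Aᵀ = 1) (i : Fin n) :
    ∑ k : Fin r, A i (Fin.castLE h k) ^ 2 ≤ 1 := by
  have h1 : ∑ k, A i k ^ 2 = 1 := by
    have := congrFun (congrFun hA i) i
    simpa [Matrix.mul_apply, sq] using this
  rw [← h1]
  have h2 := Finset.sum_map (Finset.univ : Finset (Fin r)) (Fin.castLEEmb h) (fun k => A i k ^ 2)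
  simp only [Fin.coe_castLEEmb] at h2
  rw [← h2]
  exact Finset.sum_le_sum_of_subset_of_nonneg (Finset.subset_univ _) (fun _ _ _ => sq_nonneg _)

lemma trace_ineq (n₁ n₂ : ℕ) (A : Matrix (Fin n₁) (Fin n₁) ℝ) (B : Matrix (Fin n₂) (Fin n₂) ℝ)
    (hA : Aᵀ * A = 1) (hA' : A * Aᵀ = 1) (hB : Bᵀ * B = 1) (hB' : B * Bᵀ = 1)
    (s σ : ℕ → ℝ)
    (hs : ∀ i j : ℕ, i ≤ j → j < min n₁ n₂ → s j ≤ s i)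
    (hs0 : ∀ i : ℕ, i < min n₁ n₂ → 0 ≤ s i)
    (hw : ∀ i j : ℕ, i ≤ j → j < min n₁ n₂ → σ j ≤ σ i)
    (hw0 : ∀ i : ℕ, i < min n₁ n₂ → 0 ≤ σ i) :
    ∑ i, ∑ j, (A * rectDiag n₁ n₂ σ * Bᵀ) i j * rectDiag n₁ n₂ s i j ≤
      ∑ i ∈ Finset.range (min n₁ n₂), s i * σ i := by
  have e := diag_sum n₁ n₂ (fun i j => s i * (A * rectDiag n₁ n₂ σ * Bᵀ) i j)
  have e' : ∑ i, ∑ j, (A * rectDiag n₁ n₂ σ * Bᵀ) i j * rectDiag n₁ n₂ s i j =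
      ∑ i : Fin n₁, ∑ j : Fin n₂, (if (i : ℕ) = (j : ℕ) then
        s i * (A * rectDiag n₁ n₂ σ * Bᵀ) i j else 0) := by
    refine Finset.sum_congr rfl fun k _ => Finset.sum_congr rfl fun l _ => ?_
    simp only [rectDiag]
    split_ifs <;> ring
  rw [e', e]
  simp only [rect_apply, Fin.val_castLE]
  set r := min n₁ n₂ with hr
  have l1 : r ≤ n₁ := min_le_left _ _
  have l2 : r ≤ n₂ := min_le_right _ _
  let p : Fin r → Fin r → ℝ := fun i k =>
    (A (Fin.castLE l1 i) (Fin.castLE l1 k) ^ 2 + B (Fin.castLE l2 i) (Fin.castLE l2 k) ^ 2) / 2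
  let P : ℕ → ℕ → ℝ := fun i k => if h : i < r ∧ k < r then p ⟨i, h.1⟩ ⟨k, h.2⟩ else 0
  have hPp : ∀ i k : Fin r, P i k = p i k := by
    intro i k
    simp [P]
  have hp0 : ∀ i k, 0 ≤ p i k := fun i k => by
    simp only [p]; positivity
  have key := substoch s σ P r hs hs0 hw hw0
    (by
      intro i k
      simp only [P]
      split_ifs
      · exact hp0 _ _
      · exact le_rfl)
    (by
      intro i hi
      rw [Finset.sum_range]
      have : ∀ k : Fin r, P i k = p ⟨i, hi⟩ k := fun k => hPp ⟨i, hi⟩ k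
      simp only [this, p, ← Finset.sum_div, Finset.sum_add_distrib]
      have h1 := sub_row l1 A hA' (Fin.castLE l1 ⟨i, hi⟩)
      have h2 := sub_row l2 B hB' (Fin.castLE l2 ⟨i, hi⟩)
      linarith)
    (by
      intro k hk
      rw [Finset.sum_range]
      have : ∀ i : Fin r, P i k = p i ⟨k, hk⟩ := fun i => hPp i ⟨k, hk⟩
      simp only [this, p, ← Finset.sum_div, Finset.sum_add_distrib]
      have h1 := sub_row l1 Aᵀ (by simpa using hA) (Fin.castLE l1 ⟨k, hk⟩)
      have h2 := sub_row l2 Bᵀ (by simpa using hB) (Fin.castLE l2 ⟨k, hk⟩)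
      simp only [Matrix.transpose_apply] at h1 h2
      linarith)
  refine le_trans ?_ key
  simp only [Finset.sum_range, hPp]
  refine Finset.sum_le_sum fun i _ => mul_le_mul_of_nonneg_left
    (Finset.sum_le_sum fun k _ => mul_le_mul_of_nonneg_left ?_ (hw0 k k.2)) (hs0 i i.2)
  simp only [p]
  nlinarith [sq_nonneg (A (Fin.castLE l1 i) (Fin.castLE l1 k) -
    B (Fin.castLE l2 i) (Fin.castLE l2 k))]

lemma orth_mul {n : ℕ} (Q U : Matrix (Fin n) (Fin n) ℝ) (hQ : Q * Qᵀ = 1) (hU : Uᵀ * U = 1) :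
    (Qᵀ * U)ᵀ * (Qᵀ * U) = 1 := by
  rw [Matrix.transpose_mul, Matrix.transpose_transpose, Matrix.mul_assoc, ← Matrix.mul_assoc Q,
    hQ, Matrix.one_mul, hU]

lemma rectDiag_sub (n₁ n₂ : ℕ) (a b : ℕ → ℝ) :
    rectDiag n₁ n₂ a - rectDiag n₁ n₂ b = rectDiag n₁ n₂ (fun i => a i - b i) := by
  ext i j
  simp only [rectDiag, Matrix.sub_apply]
  split_ifs <;> ring

/-- Singular-value shrinkage solves the spectral-penalty proximal problem:
(a) the closed form of `‖W* − D‖_F²`, and (b) `W*` minimizes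
`W ↦ λ Σ ψ(σ_i(W)) + (ρ/2)‖W − D‖_F²` among all matrices with an SVD. -/
theorem singular_value_shrinkage (n₁ n₂ : ℕ)
    (D : Matrix (Fin n₁) (Fin n₂) ℝ)
    (Q : Matrix (Fin n₁) (Fin n₁) ℝ) (Rm : Matrix (Fin n₂) (Fin n₂) ℝ)
    (s : ℕ → ℝ)
    (hQ : Qᵀ * Q = 1) (hQ' : Q * Qᵀ = 1)
    (hR : Rmᵀ * Rm = 1) (hR' : Rm * Rmᵀ = 1)
    (hsdesc : ∀ i j : ℕ, i ≤ j → j < min n₁ n₂ → s j ≤ s i)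
    (hsnonneg : ∀ i : ℕ, i < min n₁ n₂ → 0 ≤ s i)
    (hD : D = Q * rectDiag n₁ n₂ s * Rmᵀ)
    (lam ρ : ℝ) (hlam : 0 < lam) (hρ : 0 < ρ)
    (ψ : ℝ → ℝ) (σstar : ℕ → ℝ)
    (hσstar : ∀ i : ℕ, i < min n₁ n₂ → 0 ≤ σstar i ∧
      ∀ x : ℝ, 0 ≤ x →
        lam * ψ (σstar i) + ρ / 2 * (σstar i - s i) ^ 2 ≤
          lam * ψ x + ρ / 2 * (x - s i) ^ 2) :
    frobSq (Q * rectDiag n₁ n₂ σstar * Rmᵀ - D) =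
        ∑ i ∈ Finset.range (min n₁ n₂), (σstar i - s i) ^ 2 ∧
      ∀ (W : Matrix (Fin n₁) (Fin n₂) ℝ)
        (U : Matrix (Fin n₁) (Fin n₁) ℝ) (V : Matrix (Fin n₂) (Fin n₂) ℝ)
        (σw : ℕ → ℝ),
        Uᵀ * U = 1 → U * Uᵀ = 1 → Vᵀ * V = 1 → V * Vᵀ = 1 →
        (∀ i j : ℕ, i ≤ j → j < min n₁ n₂ → σw j ≤ σw i) →
        (∀ i : ℕ, i < min n₁ n₂ → 0 ≤ σw i) →
        W = U * rectDiag n₁ n₂ σw * Vᵀ →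
        lam * ∑ i ∈ Finset.range (min n₁ n₂), ψ (σstar i) +
            ρ / 2 * ∑ i ∈ Finset.range (min n₁ n₂), (σstar i - s i) ^ 2 ≤
          lam * ∑ i ∈ Finset.range (min n₁ n₂), ψ (σw i) + ρ / 2 * frobSq (W - D) := by
  subst hD
  constructor
  · rw [← Matrix.sub_mul, ← Matrix.mul_sub, frobSq_orth _ _ _ hQ hR, rectDiag_sub,
      frobSq_rectDiag]
  intro W U V σw hU hU' hV hV' hw hw0 hW
  have hA := orth_mul Q U hQ' hU
  have hA' := mul_eq_one_comm.1 hA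
  have hB := orth_mul Rm V hR' hV
  have hB' := mul_eq_one_comm.1 hB
  have e1 : W - Q * rectDiag n₁ n₂ s * Rmᵀ =
      Q * ((Qᵀ * U) * rectDiag n₁ n₂ σw * (Rmᵀ * V)ᵀ - rectDiag n₁ n₂ s) * Rmᵀ := by
    have : Q * ((Qᵀ * U) * rectDiag n₁ n₂ σw * (Rmᵀ * V)ᵀ) * Rmᵀ =
        (Q * Qᵀ) * (U * rectDiag n₁ n₂ σw * Vᵀ) * (Rm * Rmᵀ) := by
      simp only [Matrix.transpose_mul, Matrix.transpose_transpose, Matrix.mul_assoc]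
    rw [Matrix.mul_sub, Matrix.sub_mul, this, hQ', hR', Matrix.one_mul, Matrix.mul_one, hW]
  have ht := trace_ineq n₁ n₂ _ _ hA hA' hB hB' s σw hsdesc hsnonneg hw hw0
  have hF : ∑ i ∈ Finset.range (min n₁ n₂), (σw i - s i) ^ 2 ≤
      frobSq (W - Q * rectDiag n₁ n₂ s * Rmᵀ) := by
    rw [e1, frobSq_orth _ _ _ hQ hR, frobSq_sub, frobSq_orth _ _ _ hA hB, frobSq_rectDiag,
      frobSq_rectDiag]
    have : ∑ i ∈ Finset.range (min n₁ n₂), (σw i - s i) ^ 2 =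
        ∑ i ∈ Finset.range (min n₁ n₂), σw i ^ 2 + ∑ i ∈ Finset.range (min n₁ n₂), s i ^ 2 -
          2 * ∑ i ∈ Finset.range (min n₁ n₂), s i * σw i := by
      rw [Finset.mul_sum, ← Finset.sum_add_distrib, ← Finset.sum_sub_distrib]
      exact Finset.sum_congr rfl fun i _ => by ring
    linarith
  have hS : ∑ i ∈ Finset.range (min n₁ n₂),
        (lam * ψ (σstar i) + ρ / 2 * (σstar i - s i) ^ 2) ≤
      ∑ i ∈ Finset.range (min n₁ n₂), (lam * ψ (σw i) + ρ / 2 * (σw i - s i) ^ 2) :=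
    Finset.sum_le_sum fun i hi => (hσstar i (Finset.mem_range.1 hi)).2 _
      (hw0 i (Finset.mem_range.1 hi))
  simp only [Finset.sum_add_distrib, ← Finset.mul_sum] at hS
  have := mul_le_mul_of_nonneg_left hF (by positivity : (0 : ℝ) ≤ ρ / 2)
  linarith
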